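/- arXiv:1811.12834 — 4 statements merged into one kernel-verified Lean document; each statement's English description precedes it below -/
import Mathlib

section
/- For every integer θ ≥ 2 there is a unique continuous function R : ℂ^θ × ℂ^θ → ℂ such that R(h_1,…,h_θ; x_1,…,x_θ) = det[ e^{h_i x_j} ]_{i,j=1}^θ · ∏_{1≤i<j≤θ} (j−i) / ( (h_i−h_j)(x_i−x_j) ) whenever h_1,…,h_θ are pairwise distinct and x_1,…,x_θ are pairwise distinct. -/
open Filter Topology Finset

noncomputable section

namespace QSpin

/-- The determinantal function `R` on tuples of pairwise distinct arguments:
`R(h;x) = det[e^{hᵢxⱼ}] ∏_{i<j} (j-i)/((hᵢ-hⱼ)(xᵢ-xⱼ))`. -/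
def Rdet {θ : ℕ} (h x : Fin θ → ℂ) : ℂ :=
  (Matrix.of fun i j : Fin θ => Complex.exp (h i * x j)).det *
    ∏ i : Fin θ, ∏ j : Fin θ,
      if i < j then (((j : ℕ) - (i : ℕ) : ℕ) : ℂ) / ((h i - h j) * (x i - x j)) else 1

end QSpin

open QSpin

namespace QSpin

/-- A non-constant affine function of one complex variable is nonzero near `0`, off `0`. -/
lemma eventually_affine_ne (a b : ℂ) (hb : b ≠ 0) : ∀ᶠ t in 𝓝[≠] (0 : ℂ), a + t * b ≠ 0 := by
  by_cases ha : a = 0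
  · filter_upwards [self_mem_nhdsWithin] with t ht
    simpa [ha] using ⟨ht, hb⟩
  · have hc : Continuous fun t : ℂ => a + t * b := by fun_prop
    have h0 : ∀ᶠ t in 𝓝 (0 : ℂ), a + t * b ≠ 0 := by
      apply hc.continuousAt.eventually_ne
      simpa using ha
    exact h0.filter_mono nhdsWithin_le_nhds

/-- Parametric integrals of `C^n` functions are `C^n`. -/
lemma contDiff_param {H : Type} [NormedAddCommGroup H] [NormedSpace ℂ H]
    [FiniteDimensional ℂ H] (n : ℕ) :
    ∀ {E : Type} [NormedAddCommGroup E] [NormedSpace ℂ E] [CompleteSpace E]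
      (F : H × ℂ → E), ContDiff ℂ n F →
      ContDiff ℂ n (fun z : H => ∫ s in (0 : ℝ)..1, F (z, (s : ℂ))) := by
  induction n with
  | zero =>
    intro E _ _ _ F hF
    have hc : Continuous F := hF.continuous
    rw [Nat.cast_zero, contDiff_zero]
    apply intervalIntegral.continuous_parametric_intervalIntegral_of_continuous'
    simp only [Function.uncurry_def]
    fun_prop
  | succ n ih =>
    intro E _ _ _ F hF
    have hF' : ContDiff ℂ (n + 1) F := by exact_mod_cast hF
    have hc : Continuous F := hF.continuous
    have hd : ContDiff ℂ n (fderiv ℂ F) := hF'.fderiv_right le_rfl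
    have hG : ContDiff ℂ n
        (fun p : H × ℂ => (fderiv ℂ F p).comp (ContinuousLinearMap.inl ℂ H ℂ)) := by
      fun_prop
    have hGc := hG.continuous
    have key := ih _ hG
    have : ((n + 1 : ℕ) : WithTop ℕ∞) = (n : WithTop ℕ∞) + 1 := by norm_cast
    rw [this, contDiff_succ_iff_hasFDerivAt]
    refine ⟨_, key, fun z₀ => ?_⟩
    have : ProperSpace H := FiniteDimensional.proper ℂ H
    have hK : IsCompact (Metric.closedBall z₀ 1 ×ˢ (Set.Icc (0 : ℝ) 1)) :=
      (isCompact_closedBall z₀ 1).prod isCompact_Icc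
    have hcont : Continuous fun p : H × ℝ =>
        (fderiv ℂ F (p.1, (p.2 : ℂ))).comp (ContinuousLinearMap.inl ℂ H ℂ) :=
      hGc.comp (f := fun p : H × ℝ => (p.1, (p.2 : ℂ))) (by fun_prop)
    obtain ⟨C, hC⟩ := hK.exists_bound_of_continuousOn hcont.continuousOn
    apply intervalIntegral.hasFDerivAt_integral_of_dominated_of_fderiv_le
      (F := fun z (s : ℝ) => F (z, (s : ℂ)))
      (F' := fun z (s : ℝ) => (fderiv ℂ F (z, (s : ℂ))).comp (ContinuousLinearMap.inl ℂ H ℂ))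
      (bound := fun _ => C) (Metric.closedBall_mem_nhds z₀ one_pos)
    · refine Eventually.of_forall fun z => Continuous.aestronglyMeasurable ?_
      fun_prop
    · apply Continuous.intervalIntegrable
      fun_prop
    · apply Continuous.aestronglyMeasurable
      exact hcont.comp (f := fun s : ℝ => (z₀, s)) (by fun_prop)
    · refine Eventually.of_forall fun t ht z hz => ?_
      rw [Set.uIoc_of_le zero_le_one] at ht
      exact hC (z, t) ⟨hz, ht.1.le, ht.2⟩
    · exact intervalIntegrable_const
    · refine Eventually.of_forall fun t ht z hz => ?_
      have h1 : HasFDerivAt F (fderiv ℂ F (z, (t : ℂ))) (z, (t : ℂ)) :=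
        ((hF'.differentiable (by simp)) _).hasFDerivAt
      exact h1.comp z (hasFDerivAt_prodMk_left z (t : ℂ))

/-- Hadamard's lemma: division by a linear functional. -/
lemma hadamard {H : Type} [NormedAddCommGroup H] [NormedSpace ℂ H]
    [FiniteDimensional ℂ H] (l : H →L[ℂ] ℂ) (v : H) (hv : l v = 1) (f : H → ℂ)
    (hf : ∀ n : ℕ, ContDiff ℂ n f) (h0 : ∀ z, l z = 0 → f z = 0) :
    ∃ g : H → ℂ, (∀ n : ℕ, ContDiff ℂ n g) ∧ ∀ z, f z = l z * g z := by
  refine ⟨fun z => ∫ s in (0 : ℝ)..1,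
    (fun p : H × ℂ => fderiv ℂ f (p.1 - (1 - p.2) • l p.1 • v) v) (z, (s : ℂ)), ?_, ?_⟩
  · intro n
    refine contDiff_param n (fun p : H × ℂ => fderiv ℂ f (p.1 - (1 - p.2) • l p.1 • v) v) ?_
    have h1 : ContDiff ℂ (n + 1) f := by exact_mod_cast hf (n + 1)
    have hd : ContDiff ℂ n (fderiv ℂ f) := h1.fderiv_right le_rfl
    have h2 : ContDiff ℂ n (fun p : H × ℂ => p.1 - (1 - p.2) • l p.1 • v) := by fun_prop
    exact (hd.comp h2).clm_apply contDiff_const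
  · intro z
    have h1 : ContDiff ℂ 1 f := by exact_mod_cast hf 1
    have hdc : Continuous (fderiv ℂ f) := h1.continuous_fderiv (by simp)
    have hder : ∀ s : ℝ, HasDerivAt (fun s : ℝ => f (z - (1 - (s : ℂ)) • l z • v))
        (l z * fderiv ℂ f (z - (1 - (s : ℂ)) • l z • v) v) s := by
      intro s
      have ha : HasDerivAt (fun s : ℂ => z - (1 - s) • l z • v) (l z • v) (s : ℂ) := by
        have := (((hasDerivAt_id (s : ℂ)).const_sub 1).smul_const (l z • v)).const_sub z
        simpa using this
      have hb := ((h1.differentiable (by simp)) (z - (1 - (s : ℂ)) • l z • v)).hasFDerivAt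
      have hcomp := (hb.comp_hasDerivAt (s : ℂ) ha).comp_ofReal
      simpa using hcomp
    have hint := intervalIntegral.integral_eq_sub_of_hasDerivAt (a := 0) (b := 1)
      (fun s _ => hder s) (by
        apply Continuous.intervalIntegrable
        fun_prop)
    rw [intervalIntegral.integral_const_mul] at hint
    simp only [hint]
    have : f (z - l z • v) = 0 := h0 _ (by simp [hv])
    simp [this]

/-- Division by a product of pairwise independent linear functionals. -/
lemma divide_prod {H ι : Type} [NormedAddCommGroup H] [NormedSpace ℂ H]
    [FiniteDimensional ℂ H] [DecidableEq ι] (l : ι → H →L[ℂ] ℂ) (S : Finset ι)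
    (hne : ∀ a ∈ S, ∃ v, l a v = 1)
    (hS : ∀ a ∈ S, ∀ b ∈ S, a ≠ b → ∃ w, l b w = 0 ∧ l a w ≠ 0) :
    ∀ f : H → ℂ, (∀ n : ℕ, ContDiff ℂ n f) → (∀ a ∈ S, ∀ z, l a z = 0 → f z = 0) →
    ∃ g : H → ℂ, (∀ n : ℕ, ContDiff ℂ n g) ∧ ∀ z, f z = (∏ a ∈ S, l a z) * g z := by
  induction S using Finset.induction_on with
  | empty => exact fun f hf _ => ⟨f, hf, by simp⟩
  | insert a S ha ih =>
    intro f hf h0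
    obtain ⟨v, hv⟩ := hne a (by simp)
    obtain ⟨g, hg, hfg⟩ := hadamard (l a) v hv f hf (h0 a (by simp))
    obtain ⟨k, hk, hgk⟩ := ih (fun b hb => hne b (by simp [hb]))
      (fun b hb c hc => hS b (by simp [hb]) c (by simp [hc])) g hg (by
        intro b hb z hz
        obtain ⟨w, hw, hw'⟩ := hS a (by simp) b (by simp [hb]) (by rintro rfl; exact ha hb)
        have hgc : Continuous g := (hg 0).continuous
        have hc : Continuous fun t : ℂ => g (z + t • w) := by fun_prop
        have ht : Tendsto (fun t : ℂ => g (z + t • w)) (𝓝[≠] 0) (𝓝 (g z)) := by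
          have := (hc.tendsto 0).mono_left (nhdsWithin_le_nhds (s := {0}ᶜ))
          simpa using this
        refine tendsto_nhds_unique ht (tendsto_const_nhds.congr' ?_)
        filter_upwards [eventually_affine_ne (l a z) (l a w) hw'] with t htne
        have h1 : f (z + t • w) = 0 := h0 b (by simp [hb]) _ (by simp [hz, hw])
        rw [hfg] at h1
        have h2 : l a (z + t • w) ≠ 0 := by simpa using htne
        exact ((mul_eq_zero.1 h1).resolve_left h2).symm)
    refine ⟨k, hk, fun z => ?_⟩
    rw [hfg, hgk, Finset.prod_insert ha, mul_assoc]

/-- Difference of two coordinates. -/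
def dcoord {θ : ℕ} (p : Fin θ × Fin θ) : (Fin θ → ℂ) →L[ℂ] ℂ :=
  ContinuousLinearMap.proj (R := ℂ) (φ := fun _ : Fin θ => ℂ) p.1
    - ContinuousLinearMap.proj (R := ℂ) (φ := fun _ : Fin θ => ℂ) p.2

@[simp] lemma dcoord_apply {θ : ℕ} (p : Fin θ × Fin θ) (h : Fin θ → ℂ) :
    dcoord p h = h p.1 - h p.2 := rfl

/-- The functionals on the product space. -/
def lfun {θ : ℕ} : (Fin θ × Fin θ) ⊕ (Fin θ × Fin θ) →
    ((Fin θ → ℂ) × (Fin θ → ℂ)) →L[ℂ] ℂ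
  | Sum.inl p => (dcoord p).comp (ContinuousLinearMap.fst ℂ _ _)
  | Sum.inr p => (dcoord p).comp (ContinuousLinearMap.snd ℂ _ _)

@[simp] lemma lfun_inl {θ : ℕ} (p : Fin θ × Fin θ) (z : (Fin θ → ℂ) × (Fin θ → ℂ)) :
    lfun (Sum.inl p) z = z.1 p.1 - z.1 p.2 := rfl

@[simp] lemma lfun_inr {θ : ℕ} (p : Fin θ × Fin θ) (z : (Fin θ → ℂ) × (Fin θ → ℂ)) :
    lfun (Sum.inr p) z = z.2 p.1 - z.2 p.2 := rfl

/-- The pairs `i < j`. -/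
def prs (θ : ℕ) : Finset (Fin θ × Fin θ) := Finset.univ.filter fun p => p.1 < p.2

lemma separate {θ : ℕ} (p q : Fin θ × Fin θ) (hp : p.1 < p.2) (hq : q.1 < q.2) (hpq : p ≠ q) :
    ∃ w : Fin θ → ℂ, w q.1 - w q.2 = 0 ∧ w p.1 - w p.2 ≠ 0 := by
  obtain ⟨i, j⟩ := p
  obtain ⟨k, l⟩ := q
  simp only at hp hq ⊢
  by_cases h1 : i ≠ k ∧ i ≠ l
  · refine ⟨Pi.single i 1, ?_, ?_⟩
    · simp [Pi.single_apply, h1.1.symm, h1.2.symm]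
    · simp [Pi.single_apply, hp.ne']
  · by_cases h2 : j ≠ k ∧ j ≠ l
    · refine ⟨Pi.single j 1, ?_, ?_⟩
      · simp [Pi.single_apply, h2.1.symm, h2.2.symm]
      · simp [Pi.single_apply, hp.ne]
    · exfalso
      apply hpq
      simp only [Prod.mk.injEq]
      grind

lemma exists_one {θ : ℕ} (p : Fin θ × Fin θ) (hp : p.1 < p.2) :
    ∃ w : Fin θ → ℂ, w p.1 - w p.2 = 1 :=
  ⟨Pi.single p.1 1, by simp [Pi.single_apply, hp.ne']⟩

lemma exists_quot (θ : ℕ) : ∃ g : (Fin θ → ℂ) × (Fin θ → ℂ) → ℂ, Continuous g ∧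
    ∀ z, (Matrix.of fun i j : Fin θ => Complex.exp (z.1 i * z.2 j)).det =
      ((∏ p ∈ prs θ, (z.1 p.1 - z.1 p.2)) * ∏ p ∈ prs θ, (z.2 p.1 - z.2 p.2)) * g z := by
  obtain ⟨g, hg, h⟩ := divide_prod (lfun (θ := θ)) ((prs θ).disjSum (prs θ)) (by
      rintro (p | p) hp
      · obtain ⟨w, hw⟩ := exists_one p (by simpa [prs] using hp)
        exact ⟨(w, 0), by simpa using hw⟩
      · obtain ⟨w, hw⟩ := exists_one p (by simpa [prs] using hp)
        exact ⟨(0, w), by simpa using hw⟩) (by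
      rintro (p | p) hp (q | q) hq hpq
      · obtain ⟨w, hw, hw'⟩ := separate p q (by simpa [prs] using hp) (by simpa [prs] using hq)
          (by simpa using hpq)
        exact ⟨(w, 0), hw, hw'⟩
      · obtain ⟨w, hw⟩ := exists_one p (by simpa [prs] using hp)
        exact ⟨(w, 0), by simp, by simp [hw]⟩
      · obtain ⟨w, hw⟩ := exists_one p (by simpa [prs] using hp)
        exact ⟨(0, w), by simp, by simp [hw]⟩
      · obtain ⟨w, hw, hw'⟩ := separate p q (by simpa [prs] using hp) (by simpa [prs] using hq)
          (by simpa using hpq)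
        exact ⟨(0, w), hw, hw'⟩)
    (fun z => (Matrix.of fun i j : Fin θ => Complex.exp (z.1 i * z.2 j)).det) (by
      intro n
      simp only [Matrix.det_apply, Matrix.of_apply]
      refine ContDiff.sum fun σ _ => ?_
      refine ContDiff.const_smul _ (contDiff_prod fun i _ => ?_)
      refine ContDiff.cexp (ContDiff.mul ?_ ?_) <;> fun_prop) (by
      rintro (p | p) hp z hz
      · have hlt : p.1 < p.2 := by simpa [prs] using hp
        refine Matrix.det_zero_of_row_eq hlt.ne ?_
        have : z.1 p.1 = z.1 p.2 := sub_eq_zero.1 hz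
        ext j
        simp [this]
      · have hlt : p.1 < p.2 := by simpa [prs] using hp
        refine Matrix.det_zero_of_column_eq hlt.ne ?_
        have : z.2 p.1 = z.2 p.2 := sub_eq_zero.1 hz
        intro i
        simp [this])
  refine ⟨g, (hg 0).continuous, fun z => ?_⟩
  rw [h z, Finset.prod_disjSum]
  simp

lemma prod_prs {θ : ℕ} (F : Fin θ → Fin θ → ℂ) :
    (∏ i : Fin θ, ∏ j : Fin θ, if i < j then F i j else 1) = ∏ p ∈ prs θ, F p.1 p.2 := by
  rw [prs, Finset.prod_filter, Fintype.prod_prod_type]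

lemma eventually_injective {θ : ℕ} (h : Fin θ → ℂ) :
    ∀ᶠ t in 𝓝[≠] (0 : ℂ), Function.Injective fun i : Fin θ => h i + t * (i : ℕ) := by
  have : ∀ᶠ t in 𝓝[≠] (0 : ℂ), ∀ i j : Fin θ, i ≠ j →
      (h i - h j) + t * (((i : ℕ) : ℂ) - ((j : ℕ) : ℂ)) ≠ 0 := by
    rw [eventually_all]
    intro i
    rw [eventually_all]
    intro j
    by_cases hij : i = j
    · simp [hij]
    · have hne : (((i : ℕ) : ℂ) - ((j : ℕ) : ℂ)) ≠ 0 := by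
        rw [sub_ne_zero]
        exact_mod_cast fun h => hij (Fin.ext h)
      exact (eventually_affine_ne _ _ hne).mono fun t ht _ => ht
  filter_upwards [this] with t ht i j hij
  by_contra hne
  apply ht i j hne
  simp only at hij
  linear_combination hij

end QSpin

/-- **Continuity of `R`** (Lemma 2.3): for every `θ ≥ 2` there is a unique continuous
function `R : ℂ^θ × ℂ^θ → ℂ` agreeing with the determinantal formula whenever the
`hᵢ` are pairwise distinct and the `xᵢ` are pairwise distinct. -/
theorem R_continuous_extension (θ : ℕ) (hθ : 2 ≤ θ) :
    ∃! R : (Fin θ → ℂ) → (Fin θ → ℂ) → ℂ,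
      (Continuous fun p : (Fin θ → ℂ) × (Fin θ → ℂ) => R p.1 p.2) ∧
      ∀ h x : Fin θ → ℂ, Function.Injective h → Function.Injective x →
        R h x = Rdet h x := by
  obtain ⟨g, hg, hdet⟩ := exists_quot θ
  refine existsUnique_of_exists_of_unique
    ⟨fun h x => g (h, x) * ∏ p ∈ prs θ, (((p.2 : ℕ) - (p.1 : ℕ) : ℕ) : ℂ), ?_, ?_⟩ ?_
  · fun_prop
  · intro h x hh hx
    have e1 : ∏ p ∈ prs θ, (h p.1 - h p.2) ≠ 0 := by
      refine Finset.prod_ne_zero_iff.2 fun p hp => ?_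
      have hlt : p.1 < p.2 := by simpa [prs] using hp
      exact sub_ne_zero.2 fun e => hlt.ne (hh e)
    have e2 : ∏ p ∈ prs θ, (x p.1 - x p.2) ≠ 0 := by
      refine Finset.prod_ne_zero_iff.2 fun p hp => ?_
      have hlt : p.1 < p.2 := by simpa [prs] using hp
      exact sub_ne_zero.2 fun e => hlt.ne (hx e)
    have hd := hdet (h, x)
    simp only at hd
    rw [Rdet, hd, prod_prs (fun i j => (((j : ℕ) - (i : ℕ) : ℕ) : ℂ) /
      ((h i - h j) * (x i - x j))), Finset.prod_div_distrib, Finset.prod_mul_distrib]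
    field_simp
  · rintro R₁ R₂ ⟨hR₁, he₁⟩ ⟨hR₂, he₂⟩
    have key : ∀ R : (Fin θ → ℂ) → (Fin θ → ℂ) → ℂ,
        (Continuous fun p : (Fin θ → ℂ) × (Fin θ → ℂ) => R p.1 p.2) → ∀ h x : Fin θ → ℂ,
        Tendsto (fun t : ℂ => R (fun i => h i + t * (i : ℕ)) (fun i => x i + t * (i : ℕ)))
          (𝓝[≠] 0) (𝓝 (R h x)) := by
      intro R hR h x
      have hc : Continuous fun t : ℂ =>
          R (fun i => h i + t * (i : ℕ)) (fun i => x i + t * (i : ℕ)) :=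
        hR.comp (f := fun t : ℂ =>
          ((fun i => h i + t * (i : ℕ) : Fin θ → ℂ), (fun i => x i + t * (i : ℕ) : Fin θ → ℂ)))
          (by fun_prop)
      have := (hc.tendsto 0).mono_left (nhdsWithin_le_nhds (s := {0}ᶜ))
      simpa using this
    funext h x
    refine tendsto_nhds_unique (key R₁ hR₁ h x) ((key R₂ hR₂ h x).congr' ?_)
    filter_upwards [eventually_injective h, eventually_injective x] with t h1 h2
    rw [he₁ _ _ h1 h2, he₂ _ _ h1 h2]
end
end

section
/- Let θ ≥ 2 be an integer, let h_1,…,h_θ ∈ ℂ be pairwise distinct, and let (λ(n))_{n≥1} be a sequence of partitions of n with at most θ parts such that λ(n)_j / n → x_j for each j = 1,…,θ. Then s_{λ(n)}( e^{h_1/n}, …, e^{h_θ/n} ) / s_{λ(n)}(1,…,1) → R(h_1,…,h_θ; x_1,…,x_θ) as n → ∞, where R is the continuous extension of the determinantal function R. -/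
open Filter Topology Finset

noncomputable section

namespace QSpin

/-- The Schur polynomial `s_λ(y₁,…,y_θ) = det[yᵢ^{λⱼ+θ-j}] / ∏_{i<j}(yᵢ-yⱼ)`
(bialternant formula, valid for pairwise distinct arguments). -/
def schur (θ : ℕ) (lam : Fin θ → ℕ) (y : Fin θ → ℂ) : ℂ :=
  (Matrix.of fun i j : Fin θ => y i ^ (lam j + (θ - 1 - (j : ℕ)))).det /
    ∏ i : Fin θ, ∏ j : Fin θ, if i < j then y i - y j else 1

/-- `s_λ(1,…,1) = ∏_{i<j} (λᵢ - i - λⱼ + j)/(j - i)`. -/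
def schurOne (θ : ℕ) (lam : Fin θ → ℕ) : ℂ :=
  ∏ i : Fin θ, ∏ j : Fin θ,
    if i < j then ((lam i : ℂ) - (lam j : ℂ) + (j : ℕ) - (i : ℕ)) / (((j : ℕ) : ℂ) - ((i : ℕ) : ℂ))
    else 1

end QSpin

open QSpin Filter Topology

/-- `n (e^{a/n} - e^{b/n}) → a - b`. -/
lemma tendsto_mul_exp_sub (a b : ℂ) :
    Tendsto (fun n : ℕ => (n : ℂ) * (Complex.exp (a / n) - Complex.exp (b / n)))
      atTop (𝓝 (a - b)) := by
  have hd : HasDerivAt (fun t : ℂ => Complex.exp (a * t) - Complex.exp (b * t)) (a - b) 0 := by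
    have ha := ((hasDerivAt_id (0 : ℂ)).const_mul a).cexp
    have hb := ((hasDerivAt_id (0 : ℂ)).const_mul b).cexp
    have hab := HasDerivAt.fun_sub ha hb
    simp only [id, mul_zero, Complex.exp_zero, one_mul, mul_one] at hab
    exact hab
  have hs := hasDerivAt_iff_tendsto_slope.1 hd
  have ht : Tendsto (fun n : ℕ => ((n : ℂ))⁻¹) atTop (𝓝[≠] 0) := by
    refine tendsto_nhdsWithin_iff.2 ⟨tendsto_inv_atTop_nhds_zero_nat (𝕜 := ℂ), ?_⟩
    filter_upwards [eventually_ge_atTop 1] with n hn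
    have : (n : ℂ) ≠ 0 := by exact_mod_cast (by omega : n ≠ 0)
    simpa using this
  refine (hs.comp ht).congr fun n => ?_
  simp [slope_def_field, div_eq_mul_inv, mul_comm]

/-- **Schur ratio limit** (Lemma 6.2): if `λ(n) ⊢ n` has at most `θ` parts and
`λ(n)ⱼ/n → xⱼ`, then `s_{λ(n)}(e^{h₁/n},…,e^{h_θ/n}) / s_{λ(n)}(1,…,1) → R(h;x)`. -/
theorem schur_ratio_limit (θ : ℕ) (hθ : 2 ≤ θ)
    (h : Fin θ → ℂ) (hdist : Function.Injective h)
    (lam : ℕ → Fin θ → ℕ)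
    (hpart : ∀ n : ℕ, 1 ≤ n → ∀ i j : Fin θ, i ≤ j → lam n j ≤ lam n i)
    (hsum : ∀ n : ℕ, 1 ≤ n → ∑ j : Fin θ, lam n j = n)
    (x : Fin θ → ℝ)
    (hlim : ∀ j : Fin θ, Tendsto (fun n : ℕ => (lam n j : ℝ) / n) atTop (𝓝 (x j)))
    -- `R` is the continuous extension of the determinantal function
    (R : (Fin θ → ℂ) → (Fin θ → ℂ) → ℂ)
    (hRcont : Continuous fun p : (Fin θ → ℂ) × (Fin θ → ℂ) => R p.1 p.2)
    (hRagree : ∀ u v : Fin θ → ℂ, Function.Injective u → Function.Injective v →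
      R u v = Rdet u v) :
    Tendsto
      (fun n : ℕ =>
        schur θ (lam n) (fun i => Complex.exp (h i / n)) / schurOne θ (lam n))
      atTop (𝓝 (R h fun j => (x j : ℂ))) := by
  set v : ℕ → Fin θ → ℂ := fun n j => ((lam n j : ℂ) + ((θ - 1 - (j : ℕ) : ℕ) : ℂ)) / n with hv
  have hvlim : Tendsto v atTop (𝓝 fun j => (x j : ℂ)) := by
    rw [tendsto_pi_nhds]
    intro j
    have h1 : Tendsto (fun n : ℕ => (((lam n j : ℝ) / n : ℝ) : ℂ)) atTop (𝓝 (x j : ℂ)) :=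
      (Complex.continuous_ofReal.tendsto _).comp (hlim j)
    have h2 : Tendsto (fun n : ℕ => ((θ - 1 - (j : ℕ) : ℕ) : ℂ) / n) atTop (𝓝 0) :=
      tendsto_const_div_atTop_nhds_zero_nat _
    have h3 := h1.add h2
    rw [add_zero] at h3
    refine h3.congr fun n => ?_
    simp only [hv]
    push_cast
    ring
  have hRlim : Tendsto (fun n => R h (v n)) atTop (𝓝 (R h fun j => (x j : ℂ))) :=
    (hRcont.tendsto (h, fun j => (x j : ℂ))).comp (tendsto_const_nhds.prodMk_nhds hvlim)
  have hc : Tendsto (fun n : ℕ => ∏ i : Fin θ, ∏ j : Fin θ, if i < j then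
      (h i - h j) / ((n : ℂ) * (Complex.exp (h i / n) - Complex.exp (h j / n))) else 1)
      atTop (𝓝 1) := by
    have : (1 : ℂ) = ∏ i : Fin θ, ∏ j : Fin θ, 1 := by simp
    refine Eq.subst (motive := fun z : ℂ => Tendsto _ atTop (𝓝 z)) this.symm ?_
    refine tendsto_finsetProd _ fun i _ => tendsto_finsetProd _ fun j _ => ?_
    split_ifs with hij
    · have hne : h i - h j ≠ 0 := sub_ne_zero.2 fun e => hij.ne (hdist e)
      have := (tendsto_const_nhds (x := h i - h j) (f := (atTop : Filter ℕ))).div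
        (tendsto_mul_exp_sub (h i) (h j)) hne
      rwa [div_self hne] at this
    · exact tendsto_const_nhds
  have hmain := hRlim.mul hc
  rw [mul_one] at hmain
  refine hmain.congr' ?_
  filter_upwards [eventually_ge_atTop 1] with n hn
  have hn0 : (n : ℂ) ≠ 0 := by exact_mod_cast (by omega : n ≠ 0)
  have hsub : ∀ i j : Fin θ, i < j →
      v n i - v n j = ((lam n i : ℂ) - lam n j + (j : ℕ) - (i : ℕ)) / n := by
    intro i j hij
    have e1 : ((θ - 1 - (i : ℕ) : ℕ) : ℂ) = (θ : ℂ) - 1 - (i : ℕ) := by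
      rw [Nat.cast_sub (by omega), Nat.cast_sub (by omega)]; simp
    have e2 : ((θ - 1 - (j : ℕ) : ℕ) : ℂ) = (θ : ℂ) - 1 - (j : ℕ) := by
      rw [Nat.cast_sub (by omega), Nat.cast_sub (by omega)]; simp
    simp only [hv, e1, e2]
    ring
  have hnum : ∀ i j : Fin θ, i < j → ((lam n i : ℂ) - lam n j + (j : ℕ) - (i : ℕ)) ≠ 0 := by
    intro i j hij e
    have e' : ((lam n i + (j : ℕ) : ℕ) : ℂ) = ((lam n j + (i : ℕ) : ℕ) : ℂ) := by
      push_cast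
      linear_combination e
    have e'' := Nat.cast_injective e'
    have := hpart n hn i j hij.le
    have : (i : ℕ) < j := hij
    omega
  have hvne : ∀ i j : Fin θ, i < j → v n i ≠ v n j := by
    intro i j hij e
    have := hsub i j hij
    rw [e, sub_self] at this
    exact div_ne_zero (hnum i j hij) hn0 this.symm
  have hvinj : Function.Injective (v n) := by
    intro i j e
    rcases lt_trichotomy i j with hij | hij | hij
    · exact absurd e (hvne i j hij)
    · exact hij
    · exact absurd e.symm (hvne j i hij)
  rw [hRagree h (v n) hdist hvinj]
  have hdet : (Matrix.of fun i j : Fin θ =>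
      Complex.exp (h i / n) ^ (lam n j + (θ - 1 - (j : ℕ)))) =
      Matrix.of fun i j : Fin θ => Complex.exp (h i * v n j) := by
    ext i j
    simp only [Matrix.of_apply, ← Complex.exp_nat_mul, hv]
    congr 1
    push_cast
    ring
  unfold Rdet schur schurOne
  rw [hdet, mul_assoc, div_div, div_eq_mul_inv]
  congr 1
  simp only [← Finset.prod_mul_distrib, ← Finset.prod_inv_distrib]
  refine Finset.prod_congr rfl fun i _ => Finset.prod_congr rfl fun j _ => ?_
  split_ifs with hij
  · have hne : h i - h j ≠ 0 := sub_ne_zero.2 fun e => hij.ne (hdist e)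
    have hij' : (i : ℕ) ≤ j := le_of_lt hij
    have hji : ((j : ℕ) : ℂ) - ((i : ℕ) : ℂ) ≠ 0 := by
      rw [sub_ne_zero]
      have hlt : (i : ℕ) < j := hij
      exact_mod_cast hlt.ne'
    rw [hsub i j hij, Nat.cast_sub hij']
    have hq := hnum i j hij
    generalize ((lam n i : ℂ) - lam n j + (j : ℕ) - (i : ℕ)) = q at hq ⊢
    generalize Complex.exp (h i / n) - Complex.exp (h j / n) = y
    generalize ((j : ℕ) : ℂ) - ((i : ℕ) : ℂ) = d at hji ⊢
    by_cases hy : y = 0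
    · simp [hy]
    · field_simp
  · simp
end
end

section
/- Let θ ≥ 2 be an integer and let R denote the continuous extension of the determinantal function R. Then for all h_1,…,h_θ ∈ ℂ and all x, y ∈ ℂ, R(h_1,…,h_θ; x, y, y, …, y) = exp( y·(h_1+…+h_θ) ) · R(h_1,…,h_θ; x−y, 0, 0, …, 0). -/
open Filter Topology Finset

noncomputable section

open QSpin

lemma eventually_inj {θ : ℕ} (u : Fin θ → ℂ) :
    ∀ᶠ t : ℂ in 𝓝[≠] 0, Function.Injective (fun i : Fin θ => u i + t * ((i : ℕ) : ℂ)) := by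
  have key : ∀ i j : Fin θ, ∀ᶠ t : ℂ in 𝓝[≠] 0,
      u i + t * ((i : ℕ) : ℂ) = u j + t * ((j : ℕ) : ℂ) → i = j := by
    intro i j
    by_cases huv : u i = u j
    · filter_upwards [self_mem_nhdsWithin] with t ht heq
      rw [huv] at heq
      have h2 := mul_left_cancel₀ ht (add_left_cancel heq)
      exact Fin.ext (by exact_mod_cast h2)
    · have hc : Continuous fun t : ℂ =>
          (u i + t * ((i : ℕ) : ℂ)) - (u j + t * ((j : ℕ) : ℂ)) := by fun_prop
      have h0 : ∀ᶠ t : ℂ in 𝓝 0,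
          (u i + t * ((i : ℕ) : ℂ)) - (u j + t * ((j : ℕ) : ℂ)) ≠ 0 := by
        apply hc.continuousAt.eventually_ne
        simpa [sub_eq_zero] using huv
      filter_upwards [nhdsWithin_le_nhds h0] with t ht heq
      exact absurd (sub_eq_zero.mpr heq) ht
  have h2 := eventually_all.mpr (fun i => eventually_all.mpr (key i))
  filter_upwards [h2] with t ht i j hij
  exact ht i j hij

lemma Rdet_shift {θ : ℕ} (u v : Fin θ → ℂ) (y : ℂ) :
    Rdet u (fun j => v j + y) = Complex.exp (y * ∑ i : Fin θ, u i) * Rdet u v := by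
  unfold Rdet
  have hd : (Matrix.of fun i j : Fin θ => Complex.exp (u i * (v j + y))).det =
      Complex.exp (y * ∑ i : Fin θ, u i) *
        (Matrix.of fun i j : Fin θ => Complex.exp (u i * v j)).det := by
    rw [Finset.mul_sum, Complex.exp_sum, ← Matrix.det_mul_column]
    congr 1
    ext i j
    simp only [Matrix.of_apply]
    rw [← Complex.exp_add]
    congr 1
    ring
  rw [hd, mul_assoc]
  simp only [add_sub_add_right_eq_sub]

/-- **Translation identity for `R`** (Eq. (D.7)): for the continuous extension `R`,
`R(h₁,…,h_θ; x, y, …, y) = e^{y(h₁+…+h_θ)} · R(h₁,…,h_θ; x-y, 0, …, 0)`. -/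
theorem R_translation_identity (θ : ℕ) (hθ : 2 ≤ θ)
    -- `R` is the continuous extension of the determinantal function
    (R : (Fin θ → ℂ) → (Fin θ → ℂ) → ℂ)
    (hRcont : Continuous fun p : (Fin θ → ℂ) × (Fin θ → ℂ) => R p.1 p.2)
    (hRagree : ∀ u v : Fin θ → ℂ, Function.Injective u → Function.Injective v →
      R u v = Rdet u v) :
    ∀ (h : Fin θ → ℂ) (x y : ℂ),
      R h (fun j => if (j : ℕ) = 0 then x else y) =
        Complex.exp (y * ∑ i : Fin θ, h i) *
          R h (fun j => if (j : ℕ) = 0 then x - y else 0) := by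
  intro h x y
  have main : ∀ u v : Fin θ → ℂ,
      R u (fun j => v j + y) = Complex.exp (y * ∑ i : Fin θ, u i) * R u v := by
    intro u v
    let U : ℂ → Fin θ → ℂ := fun t i => u i + t * ((i : ℕ) : ℂ)
    let V : ℂ → Fin θ → ℂ := fun t i => v i + t * ((i : ℕ) : ℂ)
    have hU : Continuous U := by fun_prop
    have hV : Continuous V := by fun_prop
    have hV' : Continuous fun t => (fun j => V t j + y : Fin θ → ℂ) := by fun_prop
    have c1 : Continuous fun t => R (U t) (fun j => V t j + y) :=
      hRcont.comp (hU.prodMk hV')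
    have c2 : Continuous fun t => Complex.exp (y * ∑ i : Fin θ, U t i) * R (U t) (V t) := by
      have c3 : Continuous fun t => R (U t) (V t) := hRcont.comp (hU.prodMk hV)
      have c4 : Continuous fun t => Complex.exp (y * ∑ i : Fin θ, U t i) := by fun_prop
      exact c4.mul c3
    have heq : (fun t => R (U t) (fun j => V t j + y)) =ᶠ[𝓝[≠] 0]
        fun t => Complex.exp (y * ∑ i : Fin θ, U t i) * R (U t) (V t) := by
      filter_upwards [eventually_inj u, eventually_inj v] with t hu hv
      rw [hRagree (U t) (V t) hu hv, hRagree (U t) _ hu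
        (fun i j hij => hv (add_right_cancel hij)), Rdet_shift]
    have t1 := (c1.tendsto 0).mono_left (nhdsWithin_le_nhds (s := {0}ᶜ))
    have t2 := (c2.tendsto 0).mono_left (nhdsWithin_le_nhds (s := {0}ᶜ))
    have := tendsto_nhds_unique (t1.congr' heq) t2
    simpa [U, V] using this
  rw [← main]
  congr 1
  funext j
  split_ifs <;> simp
end
end

section
/- Fix S ∈ {1/2, 1, 3/2, …}, set θ = 2S+1, and let R denote the continuous extension of the determinantal function R. Then for all h, x, y ∈ ℂ, with h_i = h·(−S + i − 1) for i = 1,…,θ, R(h_1,…,h_θ; x, y, y, …, y) = ( sinh( h(x−y)/2 ) / ( h(x−y)/2 ) )^{θ−1}, where the right-hand side is interpreted as 1 when h(x−y) = 0. In particular R(−Sh, (−S+1)h, …, Sh; 1, 0, …, 0) = ( sinh(h/2)/(h/2) )^{2S}. -/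
open Filter Topology Finset

noncomputable section

open QSpin


namespace QSpin

/-- `sinh z / z`, extended by `1` at `0`. -/
def sinhc (z : ℂ) : ℂ := dslope Complex.sinh 0 z

lemma continuous_sinhc : Continuous sinhc := by
  rw [continuous_iff_continuousAt]
  intro z
  by_cases hz : z = 0
  · subst hz
    exact continuousAt_dslope_same.2 Complex.differentiable_sinh.differentiableAt
  · exact (continuousAt_dslope_of_ne hz).2 Complex.continuous_sinh.continuousAt

lemma sinhc_zero : sinhc 0 = 1 := by
  simp [sinhc, dslope_same]

lemma sinhc_ne {z : ℂ} (hz : z ≠ 0) : sinhc z = Complex.sinh z / z := by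
  rw [sinhc, dslope_of_ne _ hz, slope_def_field]
  simp

lemma sinhc_neg (z : ℂ) : sinhc (-z) = sinhc z := by
  by_cases hz : z = 0
  · simp [hz]
  · rw [sinhc_ne hz, sinhc_ne (neg_ne_zero.2 hz), Complex.sinh_neg, neg_div_neg_eq]

lemma prod_pairs (n : ℕ) (a : Fin (n + 1) → ℂ) :
    (∏ i, ∏ j, if i < j then a i * a j else 1) = ∏ j, a j ^ n := by
  induction n with
  | zero => simp
  | succ n ih =>
    rw [Fin.prod_univ_succ]
    have h1 : ∀ i : Fin (n + 1), (∏ j, if i.succ < j then a i.succ * a j else 1)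
        = ∏ j : Fin (n + 1), if i < j then a i.succ * a j.succ else 1 := by
      intro i
      rw [Fin.prod_univ_succ]
      simp
    simp_rw [h1]
    rw [ih (fun i => a i.succ), Fin.prod_univ_succ, Fin.prod_univ_succ (fun j => a j ^ (n + 1))]
    simp only [lt_irrefl, if_false, Fin.succ_pos, if_true, one_mul, Finset.prod_mul_distrib,
      Finset.prod_const, Finset.card_univ, Fintype.card_fin, pow_succ]
    ring

lemma pair_identity (h u v p q N : ℂ) (hh : h ≠ 0) (huv : u ≠ v) (hpq : p ≠ q) :
    (Complex.exp (-(h * u / 2)) * Complex.exp (-(h * v / 2))) *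
      (Complex.exp (h * v) - Complex.exp (h * u)) *
      ((q - p) / ((h * (p - N) - h * (q - N)) * (u - v))) = sinhc (h * (v - u) / 2) := by
  have hvu : v - u ≠ 0 := sub_ne_zero.2 huv.symm
  have hqp : q - p ≠ 0 := sub_ne_zero.2 hpq.symm
  rw [sinhc_ne (by simp [hh, hvu]), Complex.sinh]
  have e : (Complex.exp (-(h * u / 2)) * Complex.exp (-(h * v / 2))) *
      (Complex.exp (h * v) - Complex.exp (h * u)) =
      Complex.exp (h * (v - u) / 2) - Complex.exp (-(h * (v - u) / 2)) := by
    rw [mul_sub, ← Complex.exp_add, ← Complex.exp_add, ← Complex.exp_add]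
    congr 2 <;> ring
  rw [e]
  have : (h * (p - N) - h * (q - N)) * (u - v) = h * (q - p) * (v - u) := by ring
  rw [this]
  field_simp

lemma Rdet_spin (n : ℕ) (h : ℂ) (hh : h ≠ 0) (x : Fin (n + 1) → ℂ) (hx : Function.Injective x) :
    Rdet (fun i : Fin (n + 1) => h * (((i : ℕ) : ℂ) - (n : ℂ) / 2)) x =
      ∏ i, ∏ j, if i < j then sinhc (h * (x j - x i) / 2) else 1 := by
  have hdet : (Matrix.of fun i j : Fin (n + 1) =>
      Complex.exp (h * (((i : ℕ) : ℂ) - (n : ℂ) / 2) * x j)).det =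
      (∏ j, Complex.exp (-(h * x j / 2)) ^ n) *
        ∏ i, ∏ j, if i < j then (Complex.exp (h * x j) - Complex.exp (h * x i)) else 1 := by
    have : (Matrix.of fun i j : Fin (n + 1) =>
      Complex.exp (h * (((i : ℕ) : ℂ) - (n : ℂ) / 2) * x j)) =
      Matrix.of fun i j => Complex.exp (-(h * x j / 2)) ^ n *
        (Matrix.vandermonde fun j => Complex.exp (h * x j)).transpose i j := by
      ext i j
      simp only [Matrix.of_apply, Matrix.transpose_apply, Matrix.vandermonde_apply]
      rw [← Complex.exp_nat_mul, ← Complex.exp_nat_mul, ← Complex.exp_add]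
      congr 1
      ring
    rw [this, Matrix.det_mul_row, Matrix.det_transpose, Matrix.det_vandermonde]
    congr 1
    refine Finset.prod_congr rfl fun i _ => ?_
    rw [← Finset.prod_filter]
    refine Finset.prod_congr ?_ fun _ _ => rfl
    ext j
    simp
  unfold Rdet
  rw [hdet, ← prod_pairs]
  simp only [← Finset.prod_mul_distrib]
  refine Finset.prod_congr rfl fun i _ => Finset.prod_congr rfl fun j _ => ?_
  split_ifs with hij
  · rw [Nat.cast_sub (le_of_lt hij)]
    refine pair_identity h (x i) (x j) _ _ _ hh (hx.ne hij.ne) ?_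
    exact_mod_cast (Fin.val_ne_of_ne hij.ne)
  · simp

lemma R_eq (n : ℕ) (R : (Fin (n + 1) → ℂ) → (Fin (n + 1) → ℂ) → ℂ)
    (hRcont : Continuous fun p : (Fin (n + 1) → ℂ) × (Fin (n + 1) → ℂ) => R p.1 p.2)
    (hRagree : ∀ u v : Fin (n + 1) → ℂ, Function.Injective u → Function.Injective v →
      R u v = Rdet u v) (h : ℂ) (x : Fin (n + 1) → ℂ) :
    R (fun i => h * (((i : ℕ) : ℂ) - (n : ℂ) / 2)) x =
      ∏ i, ∏ j, if i < j then sinhc (h * (x j - x i) / 2) else 1 := by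
  let F : ℂ → ℂ := fun t =>
    R (fun i => (h + t) * (((i : ℕ) : ℂ) - (n : ℂ) / 2)) (fun j => x j + t * ((j : ℕ) : ℂ))
  let G : ℂ → ℂ := fun t =>
    ∏ i : Fin (n + 1), ∏ j : Fin (n + 1), if i < j then
      sinhc ((h + t) * ((x j + t * ((j : ℕ) : ℂ)) - (x i + t * ((i : ℕ) : ℂ))) / 2) else 1
  have hF : Continuous F := by
    have : Continuous fun t : ℂ => ((fun i : Fin (n + 1) => (h + t) * (((i : ℕ) : ℂ) - (n : ℂ) / 2)),
      (fun j : Fin (n + 1) => x j + t * ((j : ℕ) : ℂ))) := by fun_prop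
    exact hRcont.comp this
  have hG : Continuous G := by
    refine continuous_finsetProd _ fun i _ => continuous_finsetProd _ fun j _ => ?_
    split_ifs
    · exact continuous_sinhc.comp (by fun_prop)
    · exact continuous_const
  have hne : ∀ c : ℂ, ∀ᶠ t in 𝓝[≠] (0 : ℂ), t ≠ c := by
    intro c
    by_cases hc : c = 0
    · subst hc
      exact self_mem_nhdsWithin
    · exact eventually_ne_nhdsWithin (Ne.symm hc)
  have hev : ∀ᶠ t in 𝓝[≠] (0 : ℂ), ∀ i j : Fin (n + 1),
      t ≠ (x j - x i) / (((i : ℕ) : ℂ) - ((j : ℕ) : ℂ)) :=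
    eventually_all.2 fun i => eventually_all.2 fun j => hne _
  have hFG : F =ᶠ[𝓝[≠] (0 : ℂ)] G := by
    filter_upwards [hev, hne (-h)] with t ht hth
    have hht : h + t ≠ 0 := fun h0 => hth (by linear_combination h0)
    have hcast : ∀ i j : Fin (n + 1), ((i : ℕ) : ℂ) = ((j : ℕ) : ℂ) → i = j := by
      intro i j hij
      exact Fin.ext (by exact_mod_cast hij)
    have hinj : Function.Injective fun j : Fin (n + 1) => x j + t * ((j : ℕ) : ℂ) := by
      intro i j hij
      by_contra hc
      have h0 : ((i : ℕ) : ℂ) - ((j : ℕ) : ℂ) ≠ 0 :=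
        sub_ne_zero.2 fun h1 => hc (hcast i j h1)
      apply ht i j
      rw [eq_div_iff h0]
      have : x i + t * ((i : ℕ) : ℂ) = x j + t * ((j : ℕ) : ℂ) := hij
      linear_combination this
    have hinj2 : Function.Injective fun i : Fin (n + 1) =>
        (h + t) * (((i : ℕ) : ℂ) - (n : ℂ) / 2) := by
      intro i j hij
      have := mul_left_cancel₀ hht hij
      exact hcast i j (by linear_combination this)
    change R _ _ = _
    rw [hRagree _ _ hinj2 hinj, Rdet_spin n _ hht _ hinj]
  have key : F 0 = G 0 := tendsto_nhds_unique_of_eventuallyEq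
    (hF.continuousAt.tendsto.mono_left nhdsWithin_le_nhds)
    (hG.continuousAt.tendsto.mono_left nhdsWithin_le_nhds) hFG
  simpa [F, G] using key

lemma R_main (n : ℕ) (R : (Fin (n + 1) → ℂ) → (Fin (n + 1) → ℂ) → ℂ)
    (hRcont : Continuous fun p : (Fin (n + 1) → ℂ) × (Fin (n + 1) → ℂ) => R p.1 p.2)
    (hRagree : ∀ u v : Fin (n + 1) → ℂ, Function.Injective u → Function.Injective v →
      R u v = Rdet u v) (h x y : ℂ) :
    R (fun i => h * (((i : ℕ) : ℂ) - (n : ℂ) / 2)) (fun j => if (j : ℕ) = 0 then x else y) =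
        (if h * (x - y) = 0 then 1
          else Complex.sinh (h * (x - y) / 2) / (h * (x - y) / 2)) ^ n := by
  rw [R_eq n R hRcont hRagree, Fin.prod_univ_succ]
  have h1 : ∀ i : Fin n, (∏ j : Fin (n + 1), if i.succ < j then
      sinhc (h * ((if (j : ℕ) = 0 then x else y) - (if (i.succ : ℕ) = 0 then x else y)) / 2)
      else 1) = 1 := by
    intro i
    rw [Fin.prod_univ_succ]
    simp [sinhc_zero]
  rw [Finset.prod_congr rfl fun i _ => h1 i, Fin.prod_univ_succ]
  have h2 : sinhc (h * (y - x) / 2) = if h * (x - y) = 0 then 1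
          else Complex.sinh (h * (x - y) / 2) / (h * (x - y) / 2) := by
    rw [show h * (y - x) / 2 = -(h * (x - y) / 2) by ring, sinhc_neg]
    split_ifs with h0
    · rw [h0, zero_div, sinhc_zero]
    · exact sinhc_ne (div_ne_zero h0 two_ne_zero)
  rw [← h2]
  simp

end QSpin

/-- **Evaluation of `R` at the equally spaced spin values** (Eq. (6.13)/(D.10)):
with `hᵢ = h(-S+i-1)`, `R(h₁,…,h_θ; x, y, …, y) = (sinh(h(x-y)/2)/(h(x-y)/2))^{θ-1}`,
and in particular `R(-Sh,…,Sh; 1, 0, …, 0) = (sinh(h/2)/(h/2))^{2S}`. -/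
theorem R_spin_evaluation (twoS : ℕ) (hS : 1 ≤ twoS)
    -- `R` is the continuous extension of the determinantal function, `θ = 2S+1`
    (R : (Fin (twoS + 1) → ℂ) → (Fin (twoS + 1) → ℂ) → ℂ)
    (hRcont : Continuous fun p : (Fin (twoS + 1) → ℂ) × (Fin (twoS + 1) → ℂ) => R p.1 p.2)
    (hRagree : ∀ u v : Fin (twoS + 1) → ℂ, Function.Injective u → Function.Injective v →
      R u v = Rdet u v) :
    (∀ (h x y : ℂ),
      R (fun i => h * (((i : ℕ) : ℂ) - (twoS : ℂ) / 2)) (fun j => if (j : ℕ) = 0 then x else y) =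
        (if h * (x - y) = 0 then 1
          else Complex.sinh (h * (x - y) / 2) / (h * (x - y) / 2)) ^ twoS) ∧
    ∀ h : ℂ,
      R (fun i => h * (((i : ℕ) : ℂ) - (twoS : ℂ) / 2)) (fun j => if (j : ℕ) = 0 then 1 else 0) =
        (if h = 0 then 1 else Complex.sinh (h / 2) / (h / 2)) ^ twoS := by
  refine ⟨fun h x y => R_main twoS R hRcont hRagree h x y, fun h => ?_⟩
  have := R_main twoS R hRcont hRagree h 1 0
  simpa only [sub_zero, mul_one] using this
end
end
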